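/- (Faà di Bruno, combinatorial version.) Let φ = (φ¹,…,φ^m): U → V be a smooth map between open sets U ⊆ ℝ^n and V ⊆ ℝ^m, let f: V → ℝ be smooth, let ℓ ≥ 1 and let i₁,…,i_ℓ ∈ {1,…,n}. For a nonempty subset I = {k₁,…,k_r} ⊆ {1,…,ℓ} write ∂^{|I|}φ^j/∂x^I := ∂^r φ^j/∂x^{i_{k₁}}⋯∂x^{i_{k_r}}. Then for every x ∈ U: ∂^ℓ(f ∘ φ)/∂x^{i₁}⋯∂x^{i_ℓ}(x) = Σ_{k=1}^{ℓ} Σ_{I₁ ⊔ ⋯ ⊔ I_k = {1,…,ℓ}} Σ_{j₁,…,j_k = 1}^{m} (∂^k f/∂y^{j₁}⋯∂y^{j_k})(φ(x)) · (∂^{|I₁|}φ^{j₁}/∂x^{I₁})(x) ⋯ (∂^{|I_k|}φ^{j_k}/∂x^{I_k})(x), where the middle sum ranges over all partitions of {1,…,ℓ} into k nonempty, unordered blocks I₁,…,I_k. -/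

import Mathlib

noncomputable section

/-- The first-order partial derivative `∂f/∂xᵢ`. -/
def pd {n : ℕ} (i : Fin n) (f : (Fin n → ℝ) → ℝ) : (Fin n → ℝ) → ℝ :=
  fun x => fderiv ℝ f x (Pi.single i 1)

/-- The iterated partial derivative `∂^ℓ f/∂x^{i₁}⋯∂x^{i_ℓ}` along a list of coordinate
directions. -/
def itpd {n : ℕ} : List (Fin n) → ((Fin n → ℝ) → ℝ) → ((Fin n → ℝ) → ℝ)
  | [], f => f
  | i :: L, f => pd i (itpd L f)

/-- The partial derivative `∂^γ` for a multi-index `γ` (used for the derivatives of `f`,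
where the order of differentiation is immaterial). -/
def pdIter {n : ℕ} (i : Fin n) : ℕ → ((Fin n → ℝ) → ℝ) → ((Fin n → ℝ) → ℝ)
  | 0, f => f
  | k+1, f => pd i (pdIter i k f)

def mpd {n : ℕ} (γ : Fin n → ℕ) (f : (Fin n → ℝ) → ℝ) : (Fin n → ℝ) → ℝ :=
  (List.ofFn fun i : Fin n => pdIter i (γ i)).foldr (fun t acc => t ∘ acc) id f

/-- `A` is a partition of `{1,…,ℓ}` into nonempty (unordered, pairwise disjoint) blocks. -/
def IsBlockPartition {ℓ : ℕ} (A : Finset (Finset (Fin ℓ))) : Prop :=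
  (∅ ∉ A) ∧ (∀ s ∈ A, ∀ t ∈ A, s ≠ t → Disjoint s t) ∧ A.biUnion id = Finset.univ

instance {ℓ : ℕ} (A : Finset (Finset (Fin ℓ))) : Decidable (IsBlockPartition A) := by
  unfold IsBlockPartition; infer_instance

open scoped ContDiff

theorem ContDiffOn.pd {n : ℕ} {s : Set (Fin n → ℝ)} (hs : IsOpen s) {f : (Fin n → ℝ) → ℝ}
    (hf : ContDiffOn ℝ ∞ f s) (i : Fin n) : ContDiffOn ℝ ∞ (_root_.pd i f) s :=
  (hf.fderiv_of_isOpen hs (by simp)).clm_apply contDiffOn_const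

theorem ContDiffOn.itpd {n : ℕ} {s : Set (Fin n → ℝ)} (hs : IsOpen s) {f : (Fin n → ℝ) → ℝ}
    (hf : ContDiffOn ℝ ∞ f s) (L : List (Fin n)) : ContDiffOn ℝ ∞ (_root_.itpd L f) s := by
  induction L with
  | nil => exact hf
  | cons i L ih => exact ih.pd hs i

theorem Set.EqOn.pd {n : ℕ} {s : Set (Fin n → ℝ)} (hs : IsOpen s) {f g : (Fin n → ℝ) → ℝ}
    (h : s.EqOn f g) (i : Fin n) : s.EqOn (_root_.pd i f) (_root_.pd i g) := fun x hx => by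
  simp only [_root_.pd, (h.eventuallyEq_of_mem (hs.mem_nhds hx)).fderiv_eq]

/-- Second partial derivatives of a smooth function commute. -/
theorem pd_comm {n : ℕ} {s : Set (Fin n → ℝ)} (hs : IsOpen s) {f : (Fin n → ℝ) → ℝ}
    (hf : ContDiffOn ℝ ∞ f s) (i j : Fin n) : s.EqOn (pd i (pd j f)) (pd j (pd i f)) := by
  intro x hx
  have hd : DifferentiableAt ℝ (fderiv ℝ f) x :=
    ((hf.fderiv_of_isOpen (m := ∞) hs (by simp)).contDiffAt (hs.mem_nhds hx)).differentiableAt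
      (by simp)
  have key (a b : Fin n) :
      pd a (pd b f) x = fderiv ℝ (fderiv ℝ f) x (Pi.single a 1) (Pi.single b 1) := by
    unfold pd
    rw [fderiv_clm_apply hd (differentiableAt_const _)]
    simp
  rw [key, key]
  exact (hf.contDiffAt (hs.mem_nhds hx)).isSymmSndFDerivAt
    (by simpa using ENat.LEInfty.out) _ _

/-- Iterated partial derivatives of a smooth function do not depend on the order of the
directions. -/
theorem List.Perm.itpd_eqOn {n : ℕ} {s : Set (Fin n → ℝ)} (hs : IsOpen s)
    {f : (Fin n → ℝ) → ℝ} (hf : ContDiffOn ℝ ∞ f s) {L L' : List (Fin n)} (h : L.Perm L') :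
    s.EqOn (itpd L f) (itpd L' f) := by
  induction h with
  | nil => exact Set.eqOn_refl _ _
  | cons i _ ih => exact ih.pd hs i
  | swap i j L => exact pd_comm hs (hf.itpd hs L) j i
  | trans _ _ ih ih' => exact ih.trans ih'

theorem itpd_append {n : ℕ} (L L' : List (Fin n)) (f : (Fin n → ℝ) → ℝ) :
    itpd (L ++ L') f = itpd L (itpd L' f) := by
  induction L with
  | nil => rfl
  | cons i L ih => exact congrArg (pd i) ih

theorem pdIter_eq_itpd {n : ℕ} (i : Fin n) (k : ℕ) (f : (Fin n → ℝ) → ℝ) :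
    pdIter i k f = itpd (List.replicate k i) f := by
  induction k with
  | zero => rfl
  | succ k ih => exact congrArg (pd i) ih

theorem mpd_eq_itpd {n : ℕ} (γ : Fin n → ℕ) (f : (Fin n → ℝ) → ℝ) :
    mpd γ f = itpd (List.ofFn fun i => List.replicate (γ i) i).flatten f := by
  have h (L : List (Fin n)) :
      (L.map fun i => pdIter i (γ i)).foldr (fun t acc => t ∘ acc) id f =
        itpd (L.map fun i => List.replicate (γ i) i).flatten f := by
    induction L with
    | nil => rfl
    | cons i L ih =>
      simp only [List.map_cons, List.foldr_cons, Function.comp_apply, List.flatten_cons, ih,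
        itpd_append, pdIter_eq_itpd]
  simp only [mpd, List.ofFn_eq_map]
  exact h _

/-- The multi-index derivative whose exponents are the fibre cardinalities of `J` is the iterated
partial derivative along the values of `J`. -/
theorem mpd_card_fiber {n k : ℕ} {s : Set (Fin n → ℝ)} (hs : IsOpen s) {f : (Fin n → ℝ) → ℝ}
    (hf : ContDiffOn ℝ ∞ f s) (J : Fin k → Fin n) :
    s.EqOn (mpd (fun j => (Finset.univ.filter fun a => J a = j).card) f)
      (itpd (List.ofFn J) f) := by
  rw [mpd_eq_itpd]
  refine List.Perm.itpd_eqOn hs hf (List.perm_iff_count.2 fun j => ?_)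
  rw [List.count_flatten, List.map_ofFn, List.sum_ofFn]
  simp only [Function.comp_apply, List.count_replicate, beq_iff_eq, Finset.sum_ite_eq',
    Finset.mem_univ, if_true]
  rw [← Multiset.coe_count, ← Fin.univ_val_map, Multiset.count_map]
  simp only [Finset.card, Finset.filter_val, eq_comm]

/-- Iterated partial derivatives are values of the iterated Fréchet derivative. -/
theorem itpd_ofFn {n : ℕ} {s : Set (Fin n → ℝ)} (hs : IsOpen s) {f : (Fin n → ℝ) → ℝ}
    (hf : ContDiffOn ℝ ∞ f s) {k : ℕ} (i : Fin k → Fin n) :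
    s.EqOn (itpd (List.ofFn i) f)
      (fun x => iteratedFDeriv ℝ k f x fun a => Pi.single (i a) 1) := by
  induction k with
  | zero => intro x hx; simp [itpd]
  | succ k ih =>
    intro x hx
    have hd : DifferentiableAt ℝ (iteratedFDeriv ℝ k f) x :=
      (hf.contDiffAt (hs.mem_nhds hx)).differentiableAt_iteratedFDeriv
        (by exact_mod_cast WithTop.coe_lt_top k)
    rw [List.ofFn_succ]
    refine ((ih fun a => i a.succ).pd hs (i 0) hx).trans ?_
    beta_reduce
    rw [iteratedFDeriv_succ_apply_left, pd,
      fderiv_continuousMultilinear_apply_const_apply hd]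
    rfl

namespace OrderedFinpartition

variable {ℓ : ℕ}

/-- The `a`-th block of an ordered partition. -/
def block (c : OrderedFinpartition ℓ) (a : Fin c.length) : Finset (Fin ℓ) :=
  Finset.univ.image (c.emb a)

/-- The set of blocks of an ordered partition. -/
def blocks (c : OrderedFinpartition ℓ) : Finset (Finset (Fin ℓ)) :=
  Finset.univ.image c.block

theorem coe_block (c : OrderedFinpartition ℓ) (a : Fin c.length) :
    (c.block a : Set (Fin ℓ)) = Set.range (c.emb a) := by
  simp [block]

theorem card_block (c : OrderedFinpartition ℓ) (a : Fin c.length) :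
    (c.block a).card = c.partSize a := by
  rw [block, Finset.card_image_of_injective _ (c.emb_strictMono a).injective, Finset.card_fin]

theorem nonempty_block (c : OrderedFinpartition ℓ) (a : Fin c.length) : (c.block a).Nonempty :=
  Finset.card_pos.1 (c.card_block a ▸ c.partSize_pos a)

theorem block_disjoint (c : OrderedFinpartition ℓ) {a b : Fin c.length} (h : a ≠ b) :
    Disjoint (c.block a) (c.block b) := by
  rw [← Finset.disjoint_coe, coe_block, coe_block]
  exact c.disjoint (Set.mem_univ a) (Set.mem_univ b) h

theorem block_injective (c : OrderedFinpartition ℓ) : Function.Injective c.block := by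
  intro a b h
  by_contra hab
  have := c.block_disjoint hab
  rw [h, disjoint_self] at this
  exact (c.nonempty_block b).ne_empty this

theorem card_blocks (c : OrderedFinpartition ℓ) : c.blocks.card = c.length := by
  rw [blocks, Finset.card_image_of_injective _ c.block_injective, Finset.card_fin]

theorem isBlockPartition_blocks (c : OrderedFinpartition ℓ) : IsBlockPartition c.blocks := by
  refine ⟨?_, ?_, ?_⟩
  · simp only [blocks, Finset.mem_image, Finset.mem_univ, true_and, not_exists]
    exact fun a => (c.nonempty_block a).ne_empty
  · simp only [blocks, Finset.mem_image, Finset.mem_univ, true_and]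
    rintro _ ⟨a, rfl⟩ _ ⟨b, rfl⟩ h
    exact c.block_disjoint fun hab => h (hab ▸ rfl)
  · ext y
    obtain ⟨a, r, rfl⟩ := c.cover y
    simp only [blocks, Finset.mem_biUnion, Finset.mem_image, Finset.mem_univ, true_and, iff_true]
    exact ⟨_, ⟨a, rfl⟩, Finset.mem_image_of_mem _ (Finset.mem_univ r)⟩

/-- The numbering of the blocks of an ordered partition. -/
def blockEquiv (c : OrderedFinpartition ℓ) : Fin c.length ≃ {s // s ∈ c.blocks} :=
  Equiv.ofBijective (fun a => ⟨c.block a, Finset.mem_image_of_mem _ (Finset.mem_univ a)⟩)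
    ⟨fun _ _ h => c.block_injective (congrArg Subtype.val h), fun ⟨s, hs⟩ => by
      obtain ⟨a, -, rfl⟩ := Finset.mem_image.1 hs
      exact ⟨a, rfl⟩⟩

@[simp]
theorem coe_blockEquiv (c : OrderedFinpartition ℓ) (a : Fin c.length) :
    (c.blockEquiv a : Finset (Fin ℓ)) = c.block a := rfl

theorem sort_block (c : OrderedFinpartition ℓ) (a : Fin c.length) :
    (c.block a).sort (· ≤ ·) = List.ofFn (c.emb a) :=
  (Finset.sortedLT_sort _).eq_of_mem_iff (c.emb_strictMono a).sortedLT_ofFn (by simp [block])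

theorem max'_block (c : OrderedFinpartition ℓ) (a : Fin c.length) :
    (c.block a).max' (c.nonempty_block a) =
      c.emb a ⟨c.partSize a - 1, Nat.sub_one_lt_of_lt (c.partSize_pos a)⟩ := by
  refine le_antisymm (Finset.max'_le _ _ _ fun y hy => ?_)
    (Finset.le_max' _ _ (Finset.mem_image_of_mem _ (Finset.mem_univ _)))
  obtain ⟨r, -, rfl⟩ := Finset.mem_image.1 hy
  exact (c.emb_strictMono a).monotone (Fin.le_def.2 (Nat.le_sub_one_of_lt r.2))

theorem strictMono_max'_block (c : OrderedFinpartition ℓ) :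
    StrictMono fun a => (c.block a).max' (c.nonempty_block a) := by
  simp only [max'_block]
  exact c.parts_strictMono

theorem ext_of_block {c d : OrderedFinpartition ℓ} (hl : c.length = d.length)
    (h : ∀ a, c.block a = d.block (Fin.cast hl a)) : c = d := by
  have hp : ∀ a, c.partSize a = d.partSize (Fin.cast hl a) := fun a => by
    rw [← card_block, ← card_block, h]
  have he : ∀ a, Set.range (c.emb a) = Set.range (d.emb (Fin.cast hl a)) := fun a => by
    rw [← coe_block, ← coe_block, h]
  clear h
  revert hl
  obtain ⟨l, p, -, e, hc, -, -, -⟩ := c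
  obtain ⟨l', p', -, e', hd, -, -, -⟩ := d
  intro hl hp he
  obtain rfl : l = l' := hl
  obtain rfl : p = p' := funext hp
  obtain rfl : e = e' := funext fun a => ((hc a).range_inj (hd a)).1 (he a)
  rfl

theorem blocks_injective : Function.Injective (blocks : OrderedFinpartition ℓ → _) := by
  intro c d h
  have hl : c.length = d.length := by rw [← card_blocks, ← card_blocks, h]
  have hsub : ∀ {c d : OrderedFinpartition ℓ}, c.blocks = d.blocks →
      ∀ a, ∃ b, d.block b = c.block a := fun {c d} h a => by
    have : c.block a ∈ d.blocks := h ▸ Finset.mem_image_of_mem _ (Finset.mem_univ a)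
    simpa [blocks] using this
  have hlast : (fun a => (c.block a).max' (c.nonempty_block a)) =
      fun a => (d.block (Fin.cast hl a)).max' (d.nonempty_block _) := by
    refine (c.strictMono_max'_block.range_inj
      (d.strictMono_max'_block.comp (Fin.castOrderIso hl).strictMono)).1 ?_
    ext y
    constructor
    · rintro ⟨a, rfl⟩
      obtain ⟨b, hb⟩ := hsub h a
      exact ⟨Fin.cast hl.symm b, by simp [hb]⟩
    · rintro ⟨a, rfl⟩
      obtain ⟨b, hb⟩ := hsub h.symm (Fin.cast hl a)
      exact ⟨b, by simp [hb]⟩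
  refine ext_of_block hl fun a => ?_
  obtain ⟨b, hb⟩ := hsub h a
  suffices b = Fin.cast hl a by rw [← hb, this]
  refine d.strictMono_max'_block.injective ?_
  simpa [hb] using congrFun hlast a

theorem exists_blocks_eq {A : Finset (Finset (Fin ℓ))} (hA : IsBlockPartition A) :
    ∃ c : OrderedFinpartition ℓ, c.blocks = A := by
  obtain ⟨h0, hdisj, hcov⟩ := hA
  have hne (s : {s // s ∈ A}) : s.1.Nonempty :=
    Finset.nonempty_iff_ne_empty.2 fun h => h0 (h ▸ s.2)
  let last (s : {s // s ∈ A}) : Fin ℓ := s.1.max' (hne s)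
  have hlast : Function.Injective last := fun s t h => by
    by_contra hst
    exact Finset.disjoint_left.1 (hdisj s s.2 t t.2 fun h' => hst (Subtype.ext h'))
      (s.1.max'_mem (hne s))
      ((show s.1.max' (hne s) = t.1.max' (hne t) from h) ▸ t.1.max'_mem (hne t))
  let M : Finset (Fin ℓ) := Finset.univ.image last
  have hex (a : Fin M.card) : ∃ s, last s = M.orderEmbOfFin rfl a := by
    simpa [M] using M.orderEmbOfFin_mem rfl a
  choose B hB using hex
  have hBinj : Function.Injective B := fun a b h =>
    (M.orderEmbOfFin rfl).injective (by rw [← hB, ← hB, h])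
  have hBsurj (s : {s // s ∈ A}) : ∃ a, B a = s := by
    have : last s ∈ Set.range (M.orderEmbOfFin rfl) := by
      rw [Finset.range_orderEmbOfFin]
      exact Finset.mem_image_of_mem _ (Finset.mem_univ s)
    obtain ⟨a, ha⟩ := this
    exact ⟨a, hlast ((hB a).trans ha)⟩
  let c : OrderedFinpartition ℓ :=
    { length := M.card
      partSize := fun a => (B a).1.card
      partSize_pos := fun a => (hne (B a)).card_pos
      emb := fun a => (B a).1.orderEmbOfFin rfl
      emb_strictMono := fun a => ((B a).1.orderEmbOfFin rfl).strictMono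
      parts_strictMono := by
        have : (fun a => (B a).1.orderEmbOfFin rfl
            ⟨(B a).1.card - 1, Nat.sub_one_lt_of_lt (hne (B a)).card_pos⟩) =
            M.orderEmbOfFin rfl := funext fun a => by
          rw [Finset.orderEmbOfFin_last rfl (hne (B a)).card_pos]
          exact hB a
        rw [this]
        exact (M.orderEmbOfFin rfl).strictMono
      disjoint := fun a _ b _ hab => by
        simp only [Function.onFun, Finset.range_orderEmbOfFin, Finset.disjoint_coe]
        exact hdisj _ (B a).2 _ (B b).2 fun h => hab (hBinj (Subtype.ext h))
      cover := fun y => by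
        have hy : y ∈ A.biUnion id := hcov ▸ Finset.mem_univ y
        obtain ⟨s, hs, hys⟩ := Finset.mem_biUnion.1 hy
        obtain ⟨a, ha⟩ := hBsurj ⟨s, hs⟩
        refine ⟨a, ?_⟩
        rw [Finset.range_orderEmbOfFin, ha]
        exact hys }
  have hblock (a : Fin M.card) : c.block a = B a :=
    Finset.coe_injective ((c.coe_block a).trans ((B a).1.range_orderEmbOfFin rfl))
  refine ⟨c, Finset.ext fun s => ?_⟩
  rw [blocks, Finset.mem_image]
  constructor
  · rintro ⟨a, -, rfl⟩
    exact hblock a ▸ (B a).2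
  · intro hs
    obtain ⟨a, ha⟩ := hBsurj ⟨s, hs⟩
    exact ⟨a, Finset.mem_univ _, (hblock a).trans (congrArg Subtype.val ha)⟩

end OrderedFinpartition

theorem sum_mpd_mul_prod_eq {m k : ℕ} {ι : Type*} [Fintype ι] [DecidableEq ι] (e : Fin k ≃ ι)
    {V : Set (Fin m → ℝ)} (hV : IsOpen V) {f : (Fin m → ℝ) → ℝ} (hf : ContDiffOn ℝ ∞ f V)
    {y : Fin m → ℝ} (hy : y ∈ V) (g : ι → Fin m → ℝ) :
    ∑ J : ι → Fin m,
        mpd (fun j => (Finset.univ.filter fun s => J s = j).card) f y * ∏ s, g s (J s) =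
      ∑ J : Fin k → Fin m, itpd (List.ofFn J) f y * ∏ a, g (e a) (J a) := by
  refine Fintype.sum_equiv (e.symm.arrowCongr (Equiv.refl _)) _ _ fun J => ?_
  rw [← mpd_card_fiber hV hf _ hy, ← e.prod_comp]
  congr 3
  ext j
  exact (Finset.card_equiv e (by simp)).symm

theorem iteratedFDeriv_apply_eq_sum_itpd {m k : ℕ} {V : Set (Fin m → ℝ)} (hV : IsOpen V)
    {f : (Fin m → ℝ) → ℝ} (hf : ContDiffOn ℝ ∞ f V) {y : Fin m → ℝ} (hy : y ∈ V)
    (w : Fin k → Fin m → ℝ) :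
    iteratedFDeriv ℝ k f y w = ∑ J : Fin k → Fin m, itpd (List.ofFn J) f y * ∏ a, w a (J a) := by
  have hw : w = fun a => ∑ j, w a j • Pi.single j (1 : ℝ) := funext fun a => pi_eq_sum_univ' _
  conv_lhs => rw [hw]
  rw [ContinuousMultilinearMap.map_sum]
  refine Finset.sum_congr rfl fun J _ => ?_
  rw [ContinuousMultilinearMap.map_smul_univ, itpd_ofFn hV hf J hy, smul_eq_mul, mul_comm]

theorem iteratedFDeriv_single_apply {n m k : ℕ} {U : Set (Fin n → ℝ)} (hU : IsOpen U)
    {φ : (Fin n → ℝ) → (Fin m → ℝ)} (hφ : ContDiffOn ℝ ∞ φ U) {x : Fin n → ℝ} (hx : x ∈ U)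
    (i : Fin k → Fin n) (j : Fin m) :
    iteratedFDeriv ℝ k φ x (fun a => Pi.single (i a) 1) j =
      itpd (List.ofFn i) (fun z => φ z j) x := by
  rw [itpd_ofFn hU (contDiffOn_pi.1 hφ j) i hx]
  have h := ContinuousLinearMap.iteratedFDeriv_comp_left
    (ContinuousLinearMap.proj (R := ℝ) (φ := fun _ : Fin m => ℝ) j)
    (hφ.contDiffAt (hU.mem_nhds hx)) (i := k) (by exact_mod_cast le_top)
  exact (DFunLike.congr_fun h _).symm

/-- Formula of Faà di Bruno, combinatorial version. -/
theorem faa_di_bruno_combinatorial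
    {n m : ℕ} (U : Set (Fin n → ℝ)) (V : Set (Fin m → ℝ))
    (hU : IsOpen U) (hV : IsOpen V)
    (φ : (Fin n → ℝ) → (Fin m → ℝ)) (hφ : ContDiffOn ℝ (⊤ : ℕ∞) φ U)
    (hφUV : Set.MapsTo φ U V)
    (f : (Fin m → ℝ) → ℝ) (hf : ContDiffOn ℝ (⊤ : ℕ∞) f V)
    (ℓ : ℕ) (hℓ : 1 ≤ ℓ) (i : Fin ℓ → Fin n) (x : Fin n → ℝ) (hx : x ∈ U) :
    itpd (List.ofFn i) (fun z => f (φ z)) x =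
      ∑ k ∈ Finset.Icc 1 ℓ,
        ∑ A ∈ Finset.univ.filter
            (fun A : Finset (Finset (Fin ℓ)) => IsBlockPartition A ∧ A.card = k),
          ∑ J : {s // s ∈ A} → Fin m,
            mpd (fun j : Fin m =>
                (Finset.univ.filter fun s : {s // s ∈ A} => J s = j).card) f (φ x) *
              ∏ s : {s // s ∈ A},
                itpd (((s : Finset (Fin ℓ)).sort (· ≤ ·)).map i) (fun z => φ z (J s)) x := by
  have hle (k : ℕ) : (k : WithTop ℕ∞) ≤ ∞ := by exact_mod_cast le_top
  have hcomp : ContDiffOn ℝ ∞ (f ∘ φ) U := hf.comp hφ hφUV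
  have hsum (F : Finset (Finset (Fin ℓ)) → ℝ) :
      ∑ k ∈ Finset.Icc 1 ℓ, ∑ A ∈ Finset.univ.filter
        (fun A : Finset (Finset (Fin ℓ)) => IsBlockPartition A ∧ A.card = k), F A =
      ∑ c : OrderedFinpartition ℓ, F c.blocks := by
    rw [Finset.sum_comm' (t' := Finset.univ.filter IsBlockPartition)
      (s' := fun A => {A.card})]
    · simp only [Finset.sum_singleton]
      refine (Finset.sum_bij (fun c _ => c.blocks) ?_ ?_ ?_ ?_).symm
      · exact fun c _ => by simpa using c.isBlockPartition_blocks
      · exact fun c _ d _ h => OrderedFinpartition.blocks_injective h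
      · intro A hA
        obtain ⟨c, hc⟩ := OrderedFinpartition.exists_blocks_eq (Finset.mem_filter.1 hA).2
        exact ⟨c, Finset.mem_univ c, hc⟩
      · exact fun c _ => rfl
    · intro k A
      simp only [Finset.mem_filter, Finset.mem_univ, true_and, Finset.mem_singleton,
        Finset.mem_Icc]
      refine ⟨fun h => ⟨h.2.2.symm, h.2.1⟩, ?_⟩
      rintro ⟨rfl, hA⟩
      obtain ⟨c, rfl⟩ := OrderedFinpartition.exists_blocks_eq hA
      rw [c.card_blocks]
      exact ⟨⟨c.length_pos hℓ, c.length_le⟩, hA, rfl⟩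
  rw [hsum (fun A => ∑ J : {s // s ∈ A} → Fin m,
    mpd (fun j : Fin m => (Finset.univ.filter fun s : {s // s ∈ A} => J s = j).card) f (φ x) *
      ∏ s : {s // s ∈ A},
        itpd (((s : Finset (Fin ℓ)).sort (· ≤ ·)).map i) (fun z => φ z (J s)) x)]
  refine (itpd_ofFn hU hcomp i hx).trans ?_
  beta_reduce
  rw [iteratedFDeriv_comp (hf.contDiffAt (hV.mem_nhds (hφUV hx))) (hφ.contDiffAt (hU.mem_nhds hx))
    (hle ℓ), FormalMultilinearSeries.taylorComp, _root_.sum_apply]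
  refine Finset.sum_congr rfl fun c _ => ?_
  rw [sum_mpd_mul_prod_eq c.blockEquiv hV hf (hφUV hx) (fun s j =>
      itpd (((s : Finset (Fin ℓ)).sort (· ≤ ·)).map i) (fun z => φ z j) x),
    FormalMultilinearSeries.compAlongOrderedFinpartition_apply]
  refine (iteratedFDeriv_apply_eq_sum_itpd hV hf (hφUV hx) _).trans ?_
  simp only [OrderedFinpartition.coe_blockEquiv, OrderedFinpartition.sort_block, List.map_ofFn,
    ← iteratedFDeriv_single_apply hU hφ hx]
  rfl
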